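/- Let A be an n-dimensional algebra with G(A) ≥ 3. Then lev(A) ≥ G(A); moreover, if A is not isomorphic to B ⊕ k^{n−G(A)} for any standard 1-generated algebra B of dimension G(A), then lev(A) ≥ G(A) + 1. -/

import Mathlib

open scoped BigOperators

noncomputable section

/-- The space of `n`-dimensional (nonassociative) algebra structures on `kⁿ`:
bilinear maps `kⁿ × kⁿ → kⁿ`. -/
abbrev AlgStr (k : Type*) [Field k] (n : ℕ) : Type _ :=
  (Fin n → k) →ₗ[k] (Fin n → k) →ₗ[k] (Fin n → k)

variable {k : Type*} [Field k]

/-- The algebra structure with prescribed structure constants `c`: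
`μ(x, y) m = ∑ i, ∑ j, x i * y j * c i j m`. -/
def ofConst {n : ℕ} (c : Fin n → Fin n → Fin n → k) : AlgStr k n :=
  ∑ i, ∑ j,
    ((LinearMap.mul k k).compl₁₂ (LinearMap.proj i) (LinearMap.proj j)).compr₂
      (LinearMap.toSpanSingleton k (Fin n → k) (c i j))

/-- The structure constants of an algebra structure in the standard basis. -/
def structConst {n : ℕ} (μ : AlgStr k n) : Fin n × Fin n × Fin n → k :=
  fun t => μ (Pi.single t.1 1) (Pi.single t.2.1 1) t.2.2

/-- A subset of `AlgStr k n` is Zariski closed if it is the common zero locus of a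
family of polynomials in the structure constants. -/
def IsZariskiClosed {n : ℕ} (S : Set (AlgStr k n)) : Prop :=
  ∃ P : Set (MvPolynomial (Fin n × Fin n × Fin n) k),
    ∀ μ : AlgStr k n, μ ∈ S ↔ ∀ p ∈ P, MvPolynomial.eval (structConst μ) p = 0

/-- The action of `GL(V)` on algebra structures: `(g • μ)(x,y) = g (μ (g⁻¹ x) (g⁻¹ y))`. -/
def transport {n : ℕ} (g : (Fin n → k) ≃ₗ[k] (Fin n → k)) (μ : AlgStr k n) :
    AlgStr k n :=
  ((μ.comp g.symm.toLinearMap).compl₂ g.symm.toLinearMap).compr₂ g.toLinearMap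

/-- The `GL(V)`-orbit of an algebra structure; two structures represent isomorphic
algebras iff they lie in the same orbit. -/
def orbit {n : ℕ} (μ : AlgStr k n) : Set (AlgStr k n) :=
  {χ | ∃ g : (Fin n → k) ≃ₗ[k] (Fin n → k), transport g μ = χ}

/-- The Zariski closure of a set of algebra structures. -/
def zclosure {n : ℕ} (S : Set (AlgStr k n)) : Set (AlgStr k n) :=
  {χ | ∀ T : Set (AlgStr k n), IsZariskiClosed T → S ⊆ T → χ ∈ T}

/-- `μ` degenerates to `χ` if `χ` lies in the Zariski closure of the orbit of `μ`. -/
def degenerates {n : ℕ} (μ χ : AlgStr k n) : Prop :=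
  χ ∈ zclosure (orbit μ)

/-- A proper degeneration: additionally `χ` is not isomorphic to `μ`. -/
def properlyDegenerates {n : ℕ} (μ χ : AlgStr k n) : Prop :=
  degenerates μ χ ∧ χ ∉ orbit μ

/-- There is a chain of `m` proper degenerations starting at `μ`. -/
def hasChain {n : ℕ} (μ : AlgStr k n) (m : ℕ) : Prop :=
  ∃ c : ℕ → AlgStr k n, c m = μ ∧ ∀ i < m, properlyDegenerates (c (i + 1)) (c i)

/-- The level of `μ` is `m`: there is a chain of `m` proper degenerations starting
at `μ` but no chain of `m+1`. -/
def levelIs {n : ℕ} (μ : AlgStr k n) (m : ℕ) : Prop :=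
  hasChain μ m ∧ ¬ hasChain μ (m + 1)

/-- The subalgebra generated by a set `s`. -/
def subalgGen {n : ℕ} (μ : AlgStr k n) (s : Set (Fin n → k)) :
    Submodule k (Fin n → k) :=
  sInf {W | s ⊆ W ∧ ∀ x ∈ W, ∀ y ∈ W, μ x y ∈ W}

/-- The generation type of `μ` is `m`: `m` is the maximal dimension of a
one-generated subalgebra. -/
def genType {n : ℕ} (μ : AlgStr k n) (m : ℕ) : Prop :=
  IsGreatest {d : ℕ | ∃ a : Fin n → k, Module.finrank k ↥(subalgGen μ {a}) = d} m

/-- A standard `1`-generated algebra: it admits a grading `A = ⊕_{i ≥ 1} A_i` with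
`dim A_1 = 1`, `A_i A_j ⊆ A_{i+j}`, generated by `A_1` as an algebra. -/
def StandardOneGenerated {m : ℕ} (μ : AlgStr k m) : Prop :=
  ∃ A : ℕ → Submodule k (Fin m → k),
    A 0 = ⊥ ∧ DirectSum.IsInternal A ∧ Module.finrank k ↥(A 1) = 1 ∧
    (∀ i j : ℕ, ∀ x ∈ A i, ∀ y ∈ A j, μ x y ∈ A (i + j)) ∧
    subalgGen μ ((A 1 : Submodule k (Fin m → k)) : Set (Fin m → k)) = ⊤

/-- Extension by zero of coordinates, `kᵐ → kⁿ`. -/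
def inclMap (k : Type*) [Field k] {m n : ℕ} (h : m ≤ n) :
    (Fin m → k) →ₗ[k] (Fin n → k) where
  toFun x i := if hi : (i : ℕ) < m then x ⟨i, hi⟩ else 0
  map_add' x y := by funext i; by_cases hi : (i : ℕ) < m <;> simp [hi]
  map_smul' a x := by funext i; by_cases hi : (i : ℕ) < m <;> simp [hi]

/-- The `n`-dimensional algebra `B ⊕ k^{n-m}` obtained from an `m`-dimensional
algebra `B` by adjoining a complement with all products zero. -/
def extendZero {m n : ℕ} (h : m ≤ n) (B : AlgStr k m) : AlgStr k n :=
  ((B.comp (LinearMap.funLeft k k (Fin.castLE h))).compl₂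
      (LinearMap.funLeft k k (Fin.castLE h))).compr₂ (inclMap k h)

/-- The `i`-th standard basis vector (as a plain function, `0` if `i ≥ n`). -/
def unitVec {k : Type*} [Field k] (n i : ℕ) : Fin n → k :=
  fun j => if (j : ℕ) = i then 1 else 0

/-- Projection onto the coordinate `0` part. -/
def proj0 (k : Type*) [Field k] (n : ℕ) : (Fin n → k) →ₗ[k] (Fin n → k) :=
  LinearMap.pi fun i => if (i : ℕ) = 0 then LinearMap.proj i else 0

/-- Projection onto the coordinates `≥ 1` part. -/
def projPos (k : Type*) [Field k] (n : ℕ) : (Fin n → k) →ₗ[k] (Fin n → k) :=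
  LinearMap.pi fun i => if (i : ℕ) = 0 then 0 else LinearMap.proj i

/-- The Inönü–Wigner contraction of `μ` with respect to the `1`-dimensional
subalgebra spanned by the first basis vector (the remaining coordinates form the
square-zero ideal part). -/
def IWcontract0 {n : ℕ} (μ : AlgStr k n) : AlgStr k n :=
  ((μ.comp (projPos k n)).compl₂ (proj0 k n)).compr₂ (projPos k n) +
    ((μ.comp (proj0 k n)).compl₂ (projPos k n)).compr₂ (projPos k n) +
    (μ.comp (proj0 k n)).compl₂ (proj0 k n)

/-- The annihilator of an algebra structure. -/
def annihilator {n : ℕ} (μ : AlgStr k n) : Submodule k (Fin n → k) where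
  carrier := {a | ∀ b, μ a b = 0 ∧ μ b a = 0}
  add_mem' := by
    intro a b ha hb
    intro c
    constructor
    · rw [map_add, LinearMap.add_apply, (ha c).1, (hb c).1, add_zero]
    · rw [map_add, (ha c).2, (hb c).2, add_zero]
  zero_mem' := by
    intro b
    constructor
    · rw [map_zero, LinearMap.zero_apply]
    · rw [map_zero]
  smul_mem' := by
    intro t a ha b
    constructor
    · rw [map_smul, LinearMap.smul_apply, (ha b).1, smul_zero]
    · rw [map_smul, (ha b).2, smul_zero]

/-- `μ` has a square-zero (two-sided) ideal of codimension `1`. -/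
def hasSqZeroIdealCodim1 {n : ℕ} (μ : AlgStr k n) : Prop :=
  ∃ I : Submodule k (Fin n → k), Module.finrank k ↥I = n - 1 ∧
    (∀ x ∈ I, ∀ y : Fin n → k, μ x y ∈ I ∧ μ y x ∈ I) ∧
    ∀ x ∈ I, ∀ y ∈ I, μ x y = 0

/-- `a` (viewed as the sequence of parts `a 0 ≥ a 1 ≥ …`) is a partition of `N`. -/
def IsPartitionOf (a : ℕ → ℕ) (N : ℕ) : Prop :=
  (∀ i j : ℕ, i ≤ j → a j ≤ a i) ∧
    ∃ l : ℕ, (∀ i, l ≤ i → a i = 0) ∧ ∑ i ∈ Finset.range l, a i = N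

/-- The dominance order on partitions: `a ⪰ b`. -/
def Dominates (a b : ℕ → ℕ) : Prop :=
  ∀ m : ℕ, ∑ i ∈ Finset.range m, b i ≤ ∑ i ∈ Finset.range m, a i

/-- `a` is the Jordan type of the matrix `M` at the eigenvalue `lam`:
`a` is a partition of the generalized eigenspace dimension, and the parts of `a`
are the sizes of the Jordan blocks of `M` with eigenvalue `lam`, expressed via
the ranks of powers of `M - lam • 1`. -/
def IsJordanTypeAt {N : ℕ} (M : Matrix (Fin N) (Fin N) k) (lam : k) (a : ℕ → ℕ) :
    Prop :=
  IsPartitionOf a (N - ((M - lam • (1 : Matrix (Fin N) (Fin N) k)) ^ N).rank) ∧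
    ∀ p : ℕ, ((M - lam • (1 : Matrix (Fin N) (Fin N) k)) ^ p).rank =
      N - ∑ i ∈ Finset.range N, min (a i) p

/-- The full specter of `M` is `{(lam i, a i)}`: the `lam i` are pairwise distinct,
each `a i` is the (nonempty) Jordan type of `M` at `lam i`, and every eigenvalue
of `M` occurs among the `lam i`. -/
def IsFullSpecter {N : ℕ} (M : Matrix (Fin N) (Fin N) k) {l : ℕ}
    (lam : Fin l → k) (a : Fin l → ℕ → ℕ) : Prop :=
  Function.Injective lam ∧
    (∀ i, IsJordanTypeAt M (lam i) (a i) ∧ a i 0 ≠ 0) ∧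
    ∀ c : k, (∃ v : Fin N → k, v ≠ 0 ∧ M.mulVec v = c • v) → ∃ i, lam i = c

/-- There is a chain of `len` strict dominance steps of partitions of `N`
starting (on top) at `a`. -/
def partChain (a : ℕ → ℕ) (N len : ℕ) : Prop :=
  ∃ c : ℕ → ℕ → ℕ, (∀ i ≤ len, IsPartitionOf (c i) N) ∧ c len = a ∧
    ∀ i < len, Dominates (c (i + 1)) (c i) ∧ c (i + 1) ≠ c i

/-- The structure `T_α^M ∈ A_{m+1}`. -/
def Tstr {m : ℕ} (α : k) (M : Matrix (Fin m) (Fin m) k) : AlgStr k (m + 1) :=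
  ofConst fun i j mm =>
    if hi : i = 0 then
      if hj : j = 0 then (if mm = 0 then α else 0)
      else if hmm : mm = 0 then 0 else M (mm.pred hmm) (j.pred hj)
    else if hj : j = 0 then
      if hmm : mm = 0 then 0 else (if i = mm then α else 0) - M (mm.pred hmm) (i.pred hi)
    else 0

/-- The trivial singular extension `k^{n-2} ⋊_{(L₁,R₁,L₂,R₂)} χ` of the
`2`-dimensional algebra `χ` given by the coefficients `c11, c12, c21, d12, d21, d22`
(with `χ(e₁,e₁) = c11·e₁ + e₂`, `χ(e₁,e₂) = c12·e₁ + d12·e₂`,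
`χ(e₂,e₁) = c21·e₁ + d21·e₂`, `χ(e₂,e₂) = d22·e₂`). -/
def sdExt {m : ℕ} (c11 c12 c21 d12 d21 d22 : k)
    (L1 R1 L2 R2 : Matrix (Fin m) (Fin m) k) : AlgStr k (m + 2) :=
  ofConst fun i j mm =>
    if hi0 : (i : ℕ) = 0 then
      if hj0 : (j : ℕ) = 0 then
        if (mm : ℕ) = 0 then c11 else if (mm : ℕ) = 1 then 1 else 0
      else if hj1 : (j : ℕ) = 1 then
        if (mm : ℕ) = 0 then c12 else if (mm : ℕ) = 1 then d12 else 0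
      else if hmm : (mm : ℕ) < 2 then 0
      else L1 ⟨(mm : ℕ) - 2, by have := mm.isLt; omega⟩
             ⟨(j : ℕ) - 2, by have := j.isLt; omega⟩
    else if hi1 : (i : ℕ) = 1 then
      if hj0 : (j : ℕ) = 0 then
        if (mm : ℕ) = 0 then c21 else if (mm : ℕ) = 1 then d21 else 0
      else if hj1 : (j : ℕ) = 1 then
        if (mm : ℕ) = 1 then d22 else 0
      else if hmm : (mm : ℕ) < 2 then 0
      else L2 ⟨(mm : ℕ) - 2, by have := mm.isLt; omega⟩
             ⟨(j : ℕ) - 2, by have := j.isLt; omega⟩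
    else
      if hj0 : (j : ℕ) = 0 then
        if hmm : (mm : ℕ) < 2 then 0
        else R1 ⟨(mm : ℕ) - 2, by have := mm.isLt; omega⟩
               ⟨(i : ℕ) - 2, by have := i.isLt; omega⟩
      else if hj1 : (j : ℕ) = 1 then
        if hmm : (mm : ℕ) < 2 then 0
        else R2 ⟨(mm : ℕ) - 2, by have := mm.isLt; omega⟩
               ⟨(i : ℕ) - 2, by have := i.isLt; omega⟩
      else 0

/-! Concrete algebra structures, given by multiplication tables on the standard
basis `e₁, …, eₙ` (0-indexed as `0, …, n-1`); all unspecified products are zero. -/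

/-- `A₃ ⊕ k^{n-2}`: `e₁e₁ = e₂`. -/
def A3str (n : ℕ) : AlgStr k n :=
  ofConst fun i j m => if (i : ℕ) = 0 ∧ (j : ℕ) = 0 ∧ (m : ℕ) = 1 then 1 else 0

/-- `n₃ ⊕ k^{n-3}`: `e₁e₂ = e₃`, `e₂e₁ = -e₃`. -/
def n3str (n : ℕ) : AlgStr k n :=
  ofConst fun i j m =>
    if (i : ℕ) = 0 ∧ (j : ℕ) = 1 ∧ (m : ℕ) = 2 then 1
    else if (i : ℕ) = 1 ∧ (j : ℕ) = 0 ∧ (m : ℕ) = 2 then -1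
    else 0

/-- `p⁻`: `e₁eᵢ = eᵢ`, `eᵢe₁ = -eᵢ` for `i ≥ 2`. -/
def pminusStr (n : ℕ) : AlgStr k n :=
  ofConst fun i j m =>
    if (i : ℕ) = 0 ∧ 1 ≤ (j : ℕ) ∧ m = j then 1
    else if 1 ≤ (i : ℕ) ∧ (j : ℕ) = 0 ∧ m = i then -1
    else 0

/-- `ν^α`: `e₁e₁ = e₁`, `e₁eᵢ = α eᵢ`, `eᵢe₁ = (1-α) eᵢ` for `i ≥ 2`. -/
def nuStr (n : ℕ) (α : k) : AlgStr k n :=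
  ofConst fun i j m =>
    if (i : ℕ) = 0 then
      if (j : ℕ) = 0 then (if (m : ℕ) = 0 then 1 else 0)
      else (if m = j then α else 0)
    else if (j : ℕ) = 0 then (if m = i then 1 - α else 0)
    else 0

/-- `k^{n-2} ⋊ E₄`: `e₁e₁ = e₁`, `e₁e₂ = e₁ + e₂`, `e₂e₂ = e₂`,
`e₁eᵢ = eᵢ`, `eᵢe₂ = eᵢ` for `i ≥ 3`.  (For `n = 2` this is `E₄`.) -/
def kE4str (n : ℕ) : AlgStr k n :=
  ofConst fun i j m =>
    if (i : ℕ) = 0 ∧ (j : ℕ) = 0 then (if (m : ℕ) = 0 then 1 else 0)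
    else if (i : ℕ) = 0 ∧ (j : ℕ) = 1 then (if (m : ℕ) = 0 ∨ (m : ℕ) = 1 then 1 else 0)
    else if (i : ℕ) = 1 ∧ (j : ℕ) = 1 then (if (m : ℕ) = 1 then 1 else 0)
    else if (i : ℕ) = 0 ∧ 2 ≤ (j : ℕ) then (if m = j then 1 else 0)
    else if 2 ≤ (i : ℕ) ∧ (j : ℕ) = 1 then (if m = i then 1 else 0)
    else 0

/-- `T₀^{2,(α,β)}`: `e₁e₂ = αe₂ + e₃`, `e₂e₁ = -αe₂ - e₃`,
`e₁eᵢ = βeᵢ`, `eᵢe₁ = -βeᵢ` for `i ≥ 3`. -/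
def T02str (n : ℕ) (α β : k) : AlgStr k n :=
  ofConst fun i j m =>
    if (i : ℕ) = 0 ∧ (j : ℕ) = 1 then
      (if (m : ℕ) = 1 then α else if (m : ℕ) = 2 then 1 else 0)
    else if (i : ℕ) = 1 ∧ (j : ℕ) = 0 then
      (if (m : ℕ) = 1 then -α else if (m : ℕ) = 2 then -1 else 0)
    else if (i : ℕ) = 0 ∧ 2 ≤ (j : ℕ) then (if m = j then β else 0)
    else if 2 ≤ (i : ℕ) ∧ (j : ℕ) = 0 then (if m = i then -β else 0)
    else 0

/-- `T₁^{2,(α,β)}`: `e₁e₁ = e₁`, `e₁e₂ = αe₂ + e₃`, `e₂e₁ = (1-α)e₂ - e₃`,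
`e₁eᵢ = βeᵢ`, `eᵢe₁ = (1-β)eᵢ` for `i ≥ 3`. -/
def T12str (n : ℕ) (α β : k) : AlgStr k n :=
  ofConst fun i j m =>
    if (i : ℕ) = 0 ∧ (j : ℕ) = 0 then (if (m : ℕ) = 0 then 1 else 0)
    else if (i : ℕ) = 0 ∧ (j : ℕ) = 1 then
      (if (m : ℕ) = 1 then α else if (m : ℕ) = 2 then 1 else 0)
    else if (i : ℕ) = 1 ∧ (j : ℕ) = 0 then
      (if (m : ℕ) = 1 then 1 - α else if (m : ℕ) = 2 then -1 else 0)
    else if (i : ℕ) = 0 ∧ 2 ≤ (j : ℕ) then (if m = j then β else 0)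
    else if 2 ≤ (i : ℕ) ∧ (j : ℕ) = 0 then (if m = i then 1 - β else 0)
    else 0

/-- `T₀³`: `e₁e₂ = e₃`, `e₂e₁ = -e₃`, `e₁e₃ = e₄`, `e₃e₁ = -e₄`. -/
def T03str (n : ℕ) : AlgStr k n :=
  ofConst fun i j m =>
    if (i : ℕ) = 0 ∧ (j : ℕ) = 1 ∧ (m : ℕ) = 2 then 1
    else if (i : ℕ) = 1 ∧ (j : ℕ) = 0 ∧ (m : ℕ) = 2 then -1
    else if (i : ℕ) = 0 ∧ (j : ℕ) = 2 ∧ (m : ℕ) = 3 then 1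
    else if (i : ℕ) = 2 ∧ (j : ℕ) = 0 ∧ (m : ℕ) = 3 then -1
    else 0

/-- `T₀^{2,2}`: `e₁e₂ = e₃`, `e₂e₁ = -e₃`, `e₁e₄ = e₅`, `e₄e₁ = -e₅`. -/
def T022str (n : ℕ) : AlgStr k n :=
  ofConst fun i j m =>
    if (i : ℕ) = 0 ∧ (j : ℕ) = 1 ∧ (m : ℕ) = 2 then 1
    else if (i : ℕ) = 1 ∧ (j : ℕ) = 0 ∧ (m : ℕ) = 2 then -1
    else if (i : ℕ) = 0 ∧ (j : ℕ) = 3 ∧ (m : ℕ) = 4 then 1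
    else if (i : ℕ) = 3 ∧ (j : ℕ) = 0 ∧ (m : ℕ) = 4 then -1
    else 0

/-- `η_l ⊕ k^{n-2l-1}`: `e_{2i-1}e_{2i} = e_{2l+1}`, `e_{2i}e_{2i-1} = -e_{2l+1}`
for `1 ≤ i ≤ l`. -/
def etaStr (n l : ℕ) : AlgStr k n :=
  ofConst fun i j m =>
    if (i : ℕ) % 2 = 0 ∧ (j : ℕ) = (i : ℕ) + 1 ∧ (i : ℕ) < 2 * l ∧ (m : ℕ) = 2 * l then 1
    else if (j : ℕ) % 2 = 0 ∧ (i : ℕ) = (j : ℕ) + 1 ∧ (j : ℕ) < 2 * l ∧ (m : ℕ) = 2 * l then -1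
    else 0

/-- `F^{α,β} ⊕ k^{n-3}`: `e₁e₁ = e₃`, `e₁e₂ = αe₃`, `e₂e₁ = βe₃`. -/
def FabStr (n : ℕ) (α β : k) : AlgStr k n :=
  ofConst fun i j m =>
    if (i : ℕ) = 0 ∧ (j : ℕ) = 0 ∧ (m : ℕ) = 2 then 1
    else if (i : ℕ) = 0 ∧ (j : ℕ) = 1 ∧ (m : ℕ) = 2 then α
    else if (i : ℕ) = 1 ∧ (j : ℕ) = 0 ∧ (m : ℕ) = 2 then β
    else 0

/-- `k^{n-2} ⋊ A₃`: `e₁e₁ = e₂`, `e₁eᵢ = eᵢ`, `eᵢe₁ = -eᵢ` for `i ≥ 3`. -/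
def kA3str (n : ℕ) : AlgStr k n :=
  ofConst fun i j m =>
    if (i : ℕ) = 0 ∧ (j : ℕ) = 0 ∧ (m : ℕ) = 1 then 1
    else if (i : ℕ) = 0 ∧ 2 ≤ (j : ℕ) then (if m = j then 1 else 0)
    else if 2 ≤ (i : ℕ) ∧ (j : ℕ) = 0 then (if m = i then -1 else 0)
    else 0

/-- `k² ⋊_{α,β} A₃ ⊕ k^{n-4}`: `e₁e₁ = e₂`, `e₁e₃ = αe₄`, `e₃e₁ = βe₄`. -/
def k2A3str (n : ℕ) (α β : k) : AlgStr k n :=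
  ofConst fun i j m =>
    if (i : ℕ) = 0 ∧ (j : ℕ) = 0 ∧ (m : ℕ) = 1 then 1
    else if (i : ℕ) = 0 ∧ (j : ℕ) = 2 ∧ (m : ℕ) = 3 then α
    else if (i : ℕ) = 2 ∧ (j : ℕ) = 0 ∧ (m : ℕ) = 3 then β
    else 0

/-- `k^{n-2} ⋊_α A₁^α`: `e₁e₁ = e₁ + e₂`, `e₁eᵢ = αeᵢ`, `eᵢe₁ = (1-α)eᵢ` for `i ≥ 2`. -/
def kA1str (n : ℕ) (α : k) : AlgStr k n :=
  ofConst fun i j m =>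
    if (i : ℕ) = 0 ∧ (j : ℕ) = 0 then (if (m : ℕ) = 0 ∨ (m : ℕ) = 1 then 1 else 0)
    else if (i : ℕ) = 0 then (if m = j then α else 0)
    else if (j : ℕ) = 0 then (if m = i then 1 - α else 0)
    else 0

/-- `k^{n-2} ⋊₁ A₂`: `e₁e₁ = e₂`, `e₁eᵢ = eᵢ`, `eᵢe₁ = -eᵢ` for `i ≥ 2`. -/
def kA2str (n : ℕ) : AlgStr k n :=
  ofConst fun i j m =>
    if (i : ℕ) = 0 ∧ (j : ℕ) = 0 then (if (m : ℕ) = 1 then 1 else 0)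
    else if (i : ℕ) = 0 then (if m = j then 1 else 0)
    else if (j : ℕ) = 0 then (if m = i then -1 else 0)
    else 0

/-- `k^{n-2} ⋊₀ᵗ B₂^α`: `e₁eᵢ = αeᵢ`, `eᵢe₁ = (1-α)eᵢ` for `i ≥ 2`. -/
def ktB2str (n : ℕ) (α : k) : AlgStr k n :=
  ofConst fun i j m =>
    if (i : ℕ) = 0 ∧ 1 ≤ (j : ℕ) then (if m = j then α else 0)
    else if 1 ≤ (i : ℕ) ∧ (j : ℕ) = 0 then (if m = i then 1 - α else 0)
    else 0

/-- `k^{n-2} ⋊₀ᵗ D₂^{α,β}`: `e₁e₁ = e₁`, `e₁eᵢ = αeᵢ`, `eᵢe₁ = βeᵢ` for `i ≥ 2`. -/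
def ktD2str (n : ℕ) (α β : k) : AlgStr k n :=
  ofConst fun i j m =>
    if (i : ℕ) = 0 ∧ (j : ℕ) = 0 then (if (m : ℕ) = 0 then 1 else 0)
    else if (i : ℕ) = 0 then (if m = j then α else 0)
    else if (j : ℕ) = 0 then (if m = i then β else 0)
    else 0


section Degenerations

variable {n : ℕ}

lemma ofConst_apply (c : Fin n → Fin n → Fin n → k) (x y : Fin n → k) (l : Fin n) :
    ofConst c x y l = ∑ i, ∑ j, x i * y j * c i j l := by
  simp [ofConst, LinearMap.sum_apply, Finset.sum_apply]

lemma structConst_ofConst (c : Fin n → Fin n → Fin n → k) (i j l : Fin n) :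
    structConst (ofConst c) (i, j, l) = c i j l := by
  simp [structConst, ofConst_apply, Pi.single_apply]

lemma structConst_injective : Function.Injective (structConst : AlgStr k n → _) := by
  intro μ ν h
  refine LinearMap.pi_ext' fun i => LinearMap.ext_ring ?_
  refine LinearMap.pi_ext' fun j => LinearMap.ext_ring ?_
  funext l
  exact congrFun h (i, j, l)

lemma eq_ofConst (μ : AlgStr k n) : μ = ofConst fun i j l => structConst μ (i, j, l) :=
  structConst_injective (funext fun ⟨i, j, l⟩ =>
    (structConst_ofConst (fun i j l => structConst μ (i, j, l)) i j l).symm)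

lemma transport_apply (g : (Fin n → k) ≃ₗ[k] (Fin n → k)) (μ : AlgStr k n) (x y : Fin n → k) :
    transport g μ x y = g (μ (g.symm x) (g.symm y)) := rfl

lemma mem_orbit_symm {μ χ : AlgStr k n} (h : χ ∈ orbit μ) : μ ∈ orbit χ := by
  obtain ⟨g, rfl⟩ := h
  refine ⟨g.symm, LinearMap.ext₂ fun x y => ?_⟩
  simp [transport_apply]

lemma mem_orbit_trans {μ χ ψ : AlgStr k n} (h : χ ∈ orbit μ) (h' : ψ ∈ orbit χ) :
    ψ ∈ orbit μ := by
  obtain ⟨g, rfl⟩ := h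
  obtain ⟨g', rfl⟩ := h'
  exact ⟨g.trans g', rfl⟩

lemma orbit_eq_of_mem {μ χ : AlgStr k n} (h : χ ∈ orbit μ) : orbit χ = orbit μ :=
  Set.Subset.antisymm (fun _ hψ => mem_orbit_trans h hψ)
    fun _ hψ => mem_orbit_trans (mem_orbit_symm h) hψ

/-- If the structure constants `c i j l` of `μ` vanish unless `d l ≤ d i + d j`, then `μ`
degenerates to the structure that keeps exactly the constants with `d l = d i + d j`. -/
lemma degenerates_of_weights [Infinite k] (μ χ : AlgStr k n) (d : Fin n → ℤ)
    (hle : ∀ i j l, structConst μ (i, j, l) ≠ 0 → d l ≤ d i + d j)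
    (hχ : ∀ i j l, structConst χ (i, j, l) =
      if d l = d i + d j then structConst μ (i, j, l) else 0) :
    degenerates μ χ := by
  rintro T ⟨P, hP⟩ hT
  rw [hP]
  intro p hp
  set f : Fin n × Fin n × Fin n → Polynomial k := fun t =>
    Polynomial.C (structConst μ t) * Polynomial.X ^ (d t.1 + d t.2.1 - d t.2.2).toNat with hf
  have heval : ∀ s : k, (MvPolynomial.aeval f p).eval s =
      MvPolynomial.eval (fun t => (f t).eval s) p := by
    intro s
    have := MvPolynomial.eval₂_comp_left (Polynomial.evalRingHom s) (algebraMap k _) f p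
    rw [MvPolynomial.aeval_def, ← Polynomial.coe_evalRingHom, this, ← MvPolynomial.eval₂_id]
    congr 1
    ext; simp
  have hzero : MvPolynomial.aeval f p = 0 := by
    refine Polynomial.eq_zero_of_infinite_isRoot _ (Set.Infinite.mono ?_
      (Set.Finite.infinite_compl (Set.finite_singleton (0 : k))))
    intro s hs
    have hs : s ≠ 0 := hs
    let g : (Fin n → k) ≃ₗ[k] (Fin n → k) := LinearEquiv.piCongrRight fun i =>
      LinearEquiv.smulOfNeZero k k (s ^ (-d i)) (zpow_ne_zero _ hs)
    have hg : ∀ x i, g x i = s ^ (-d i) * x i := fun x i => rfl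
    have hgs : ∀ i, g.symm (Pi.single i 1) = s ^ d i • Pi.single i 1 := by
      intro i
      rw [LinearEquiv.symm_apply_eq]
      funext j
      rw [hg]
      by_cases hij : j = i
      · subst hij; simp [zpow_ne_zero _ hs]
      · simp [hij]
    have hmem := (hP _).1 (hT ⟨g, rfl⟩) p hp
    rw [Set.mem_ofPred_eq, Polynomial.IsRoot.def, heval, ← hmem]
    congr 2
    funext ⟨i, j, l⟩
    have : structConst (transport g μ) (i, j, l) =
        s ^ (-d l) * (s ^ d i * (s ^ d j * structConst μ (i, j, l))) := by
      simp only [structConst, transport_apply, hgs, hg, map_smul, LinearMap.smul_apply,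
        Pi.smul_apply, smul_eq_mul]
      ring
    rw [this]
    simp only [hf, Polynomial.eval_mul, Polynomial.eval_C, Polynomial.eval_pow, Polynomial.eval_X]
    by_cases hc : structConst μ (i, j, l) = 0
    · simp [hc]
    · have h0 : 0 ≤ d i + d j - d l := by linarith [hle i j l hc]
      rw [← zpow_natCast, Int.toNat_of_nonneg h0, zpow_sub₀ hs, zpow_add₀ hs, zpow_neg]
      field_simp
  have := heval 0
  rw [hzero, Polynomial.eval_zero] at this
  rw [this]
  congr 2
  funext ⟨i, j, l⟩
  rw [hχ]
  simp only [hf, Polynomial.eval_mul, Polynomial.eval_C, Polynomial.eval_pow, Polynomial.eval_X]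
  by_cases hc : structConst μ (i, j, l) = 0
  · simp [hc]
  · have h0 := hle i j l hc
    split_ifs with h
    · simp [h]
    · rw [zero_pow (by omega), mul_zero]

lemma degenerates_of_mem_orbit {μ μ' χ : AlgStr k n} (h : μ' ∈ orbit μ)
    (h' : degenerates μ' χ) : degenerates μ χ := by
  rwa [degenerates, ← orbit_eq_of_mem h]

lemma hasChain.cons {μ χ : AlgStr k n} {m : ℕ} (h : hasChain χ m)
    (h' : properlyDegenerates μ χ) : hasChain μ (m + 1) := by
  obtain ⟨c, hc, hcs⟩ := h
  refine ⟨Function.update c (m + 1) μ, by simp, fun i hi => ?_⟩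
  rcases Nat.lt_succ_iff_lt_or_eq.1 hi with hi | rfl
  · rw [Function.update_of_ne (by omega), Function.update_of_ne (by omega)]
    exact hcs i hi
  · rw [Function.update_self, Function.update_of_ne (by omega), hc]
    exact h'

lemma hasChain.of_succ {μ : AlgStr k n} {m : ℕ} (h : hasChain μ (m + 1)) : hasChain μ m := by
  obtain ⟨c, hc, hcs⟩ := h
  exact ⟨fun i => c (i + 1), hc, fun i hi => hcs (i + 1) (by omega)⟩

lemma hasChain.of_mem_orbit {μ χ : AlgStr k n} {m : ℕ} (hm : m ≠ 0) (h : hasChain χ m)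
    (h' : χ ∈ orbit μ) : hasChain μ m := by
  obtain ⟨m, rfl⟩ := Nat.exists_eq_succ_of_ne_zero hm
  obtain ⟨c, hc, hcs⟩ := h
  have hlast := hcs m (by omega)
  rw [hc, properlyDegenerates, degenerates, orbit_eq_of_mem h'] at hlast
  exact hasChain.cons ⟨c, rfl, fun i hi => hcs i (by omega)⟩ hlast

/-- The span of all products. -/
def productSpan (μ : AlgStr k n) : Submodule k (Fin n → k) :=
  Submodule.span k (Set.range fun p : (Fin n → k) × (Fin n → k) => μ p.1 p.2)

lemma finrank_productSpan_of_mem_orbit {μ χ : AlgStr k n} (h : χ ∈ orbit μ) :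
    Module.finrank k (productSpan χ) = Module.finrank k (productSpan μ) := by
  obtain ⟨g, rfl⟩ := h
  have : productSpan (transport g μ) = (productSpan μ).map g.toLinearMap := by
    rw [productSpan, productSpan, Submodule.map_span, ← Set.range_comp]
    congr 1
    ext v
    constructor
    · rintro ⟨⟨x, y⟩, rfl⟩
      exact ⟨(g.symm x, g.symm y), rfl⟩
    · rintro ⟨⟨x, y⟩, rfl⟩
      exact ⟨(g x, g y), by simp [transport_apply]⟩
  rw [this]
  exact LinearEquiv.finrank_map_eq g _

lemma productSpan_le_iff (μ : AlgStr k n) (W : Submodule k (Fin n → k)) :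
    productSpan μ ≤ W ↔ ∀ i j, μ (Pi.single i 1) (Pi.single j 1) ∈ W := by
  constructor
  · intro h i j
    exact h (Submodule.subset_span ⟨(_, _), rfl⟩)
  · intro h
    rw [productSpan, Submodule.span_le]
    rintro _ ⟨⟨x, y⟩, rfl⟩
    have : μ x y = ∑ i, ∑ j, (x i * y j) • μ (Pi.single i 1) (Pi.single j 1) := by
      conv_lhs => rw [eq_ofConst μ]
      funext l
      simp [ofConst_apply, structConst, Finset.sum_apply]
    simp only [SetLike.mem_coe]
    rw [this]
    exact Submodule.sum_mem _ fun i _ => Submodule.sum_mem _ fun j _ =>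
      Submodule.smul_mem _ _ (h i j)

end Degenerations

section Chains

variable {n : ℕ}

/-- In the standard basis, `χ` is a graded nilpotent structure on the span of the first `m` basis
vectors, the remaining ones annihilate everything, and each of the first `m` basis vectors except
the zeroth is a product of two basis vectors. -/
def IsGradedMonomial (m : ℕ) (χ : AlgStr k n) : Prop :=
  (∃ d : Fin n → ℕ, (∀ i, 1 ≤ d i ∧ ((i : ℕ) = 0 → d i = 1)) ∧
    ∀ i j l, structConst χ (i, j, l) ≠ 0 → d l = d i + d j) ∧
  (∀ i j l, structConst χ (i, j, l) ≠ 0 → i < l ∧ j < l ∧ (l : ℕ) < m) ∧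
  ∀ l : Fin n, 1 ≤ (l : ℕ) → (l : ℕ) < m →
    ∃ i j, χ (Pi.single i 1) (Pi.single j 1) = Pi.single l 1

lemma IsGradedMonomial.finrank_productSpan {m : ℕ} {χ : AlgStr k n}
    (h : IsGradedMonomial (m + 1) χ) (hmn : m + 1 ≤ n) :
    Module.finrank k (productSpan χ) = m := by
  obtain ⟨-, htri, hgen⟩ := h
  let s : Fin m → Fin n := fun l => ⟨l + 1, by omega⟩
  have hs : Function.Injective s := fun a b hab => by
    have := congrArg Fin.val hab
    simp only [s] at this
    exact Fin.ext (by omega)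
  have hspan : productSpan χ =
      Submodule.span k (Set.range fun l => (Pi.single (s l) 1 : Fin n → k)) := by
    refine le_antisymm ((productSpan_le_iff _ _).2 fun i j => ?_) (Submodule.span_le.2 ?_)
    · rw [← Finset.univ_sum_single (χ (Pi.single i 1) (Pi.single j 1))]
      refine Submodule.sum_mem _ fun l _ => ?_
      by_cases hc : structConst χ (i, j, l) = 0
      · have : χ (Pi.single i 1) (Pi.single j 1) l = 0 := hc
        rw [this, Pi.single_zero]
        exact Submodule.zero_mem _
      · obtain ⟨hil, -, hlm⟩ := htri i j l hc
        have hil : (i : ℕ) < l := hil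
        have : (Pi.single l (χ (Pi.single i 1) (Pi.single j 1) l) : Fin n → k) =
            χ (Pi.single i 1) (Pi.single j 1) l • Pi.single l 1 := by
          rw [← Pi.single_smul, smul_eq_mul, mul_one]
        rw [this]
        refine Submodule.smul_mem _ _ (Submodule.subset_span ⟨⟨l - 1, by omega⟩, ?_⟩)
        have : s ⟨l - 1, by omega⟩ = l := Fin.ext (by simp only [s]; omega)
        simp only [this]
    · rintro _ ⟨l, rfl⟩
      obtain ⟨i, j, hij⟩ := hgen (s l) (by simp [s]) (by simp [s])
      exact Submodule.subset_span ⟨(_, _), hij⟩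
  rw [hspan, finrank_span_eq_card, Fintype.card_fin]
  have := (Pi.basisFun k (Fin n)).linearIndependent.comp s hs
  convert this using 1
  funext l
  simp

lemma IsGradedMonomial.exists_properlyDegenerates [Infinite k] {m : ℕ} {χ : AlgStr k n}
    (h : IsGradedMonomial (m + 2) χ) (hmn : m + 2 ≤ n) :
    ∃ ψ : AlgStr k n, IsGradedMonomial (m + 1) ψ ∧ properlyDegenerates χ ψ := by
  have hrank := h.finrank_productSpan hmn
  obtain ⟨⟨d, hd, hgr⟩, htri, hgen⟩ := h
  let ψ : AlgStr k n := ofConst fun i j l =>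
    if (l : ℕ) = m + 1 then 0 else structConst χ (i, j, l)
  have hψ : ∀ i j l, structConst ψ (i, j, l) =
      if (l : ℕ) = m + 1 then 0 else structConst χ (i, j, l) := structConst_ofConst _
  have hψgr : IsGradedMonomial (m + 1) ψ := by
    refine ⟨⟨d, hd, fun i j l hl => hgr i j l ?_⟩, fun i j l hl => ?_, fun l h1 hl => ?_⟩
    · rw [hψ] at hl
      exact (ite_ne_left_iff.1 hl).2.symm
    · rw [hψ] at hl
      split_ifs at hl with hlm
      · exact absurd rfl hl
      · have := htri i j l hl
        omega
    · obtain ⟨i, j, hij⟩ := hgen l h1 (by omega)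
      refine ⟨i, j, funext fun l' => ?_⟩
      have h1 := hψ i j l'
      have h2 : structConst χ (i, j, l') = (Pi.single l 1 : Fin n → k) l' := congrFun hij l'
      rw [h2] at h1
      refine h1.trans ?_
      split_ifs with hl'
      · rw [Pi.single_eq_of_ne]
        rintro rfl
        omega
      · rfl
  refine ⟨ψ, hψgr, degenerates_of_weights χ ψ (fun l => if (l : ℕ) = m + 1 then -1 else 0) ?_ ?_,
    fun hmem => ?_⟩
  · intro i j l hl
    have := htri i j l hl
    have hi : (i : ℕ) ≠ m + 1 := by omega
    have hj : (j : ℕ) ≠ m + 1 := by omega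
    simp only [hi, hj, if_false]
    split_ifs <;> simp
  · intro i j l
    rw [hψ]
    by_cases hc : structConst χ (i, j, l) = 0
    · simp [hc]
    · have := htri i j l hc
      have hi : (i : ℕ) ≠ m + 1 := by omega
      have hj : (j : ℕ) ≠ m + 1 := by omega
      by_cases hl : (l : ℕ) = m + 1 <;> simp [hi, hj, hl]
  · have := finrank_productSpan_of_mem_orbit hmem
    rw [hrank, hψgr.finrank_productSpan (by omega)] at this
    omega

/-- The linear automorphism `x ↦ x - (x i) • e_j` for `i ≠ j`. -/
def shear (k : Type*) [Field k] {n : ℕ} {i j : Fin n} (h : i ≠ j) :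
    (Fin n → k) ≃ₗ[k] (Fin n → k) where
  toFun x := x - x i • Pi.single j 1
  invFun x := x + x i • Pi.single j 1
  map_add' x y := by simp only [Pi.add_apply, add_smul]; abel
  map_smul' a x := by simp [smul_sub, mul_smul]
  left_inv x := by simp [h]
  right_inv x := by simp [h]

lemma shear_symm_apply {i j : Fin n} (h : i ≠ j) (x : Fin n → k) :
    (shear k h).symm x = x + x i • Pi.single j 1 := rfl

lemma IsGradedMonomial.structConst_shear {χ : AlgStr k n} (h : IsGradedMonomial 3 χ)
    {p q : Fin n} (hq : (q : ℕ) = 2) (hpq : p ≠ q) (i j l : Fin n) :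
    structConst (transport (shear k hpq) χ) (i, j, l) =
      structConst χ (i, j, l) - if l = q then structConst χ (i, j, p) else 0 := by
  obtain ⟨-, htri, -⟩ := h
  have hl : ∀ j, χ (Pi.single q 1) (Pi.single j 1) = 0 := fun j => funext fun l => by
    by_contra hc
    have := htri q j l hc
    omega
  have hr : ∀ j, χ (Pi.single j 1) (Pi.single q 1) = 0 := fun j => funext fun l => by
    by_contra hc
    have := htri j q l hc
    omega
  simp only [structConst, transport_apply, shear_symm_apply, map_add, LinearMap.add_apply,
    map_smul, LinearMap.smul_apply, hl, hr, smul_zero, add_zero]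
  simp [shear, Pi.single_apply]

lemma IsGradedMonomial.hasChain_three [Infinite k] {χ : AlgStr k n} (h : IsGradedMonomial 3 χ)
    (hn : 3 ≤ n) : hasChain χ 3 := by
  have hrank := h.finrank_productSpan hn
  obtain ⟨z, hz⟩ : ∃ z : Fin n, (z : ℕ) = 0 := ⟨⟨0, by omega⟩, rfl⟩
  obtain ⟨p, hp⟩ : ∃ p : Fin n, (p : ℕ) = 1 := ⟨⟨1, by omega⟩, rfl⟩
  obtain ⟨q, hq⟩ : ∃ q : Fin n, (q : ℕ) = 2 := ⟨⟨2, by omega⟩, rfl⟩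
  have hzp : z ≠ p := by rintro rfl; omega
  have hzq : z ≠ q := by rintro rfl; omega
  have hpq : p ≠ q := by rintro rfl; omega
  have hshear := h.structConst_shear hq hpq
  obtain ⟨⟨d, hd, hgr⟩, htri, hgen⟩ := h
  have hsc : ∀ i j l, χ (Pi.single i 1) (Pi.single j 1) = Pi.single l 1 →
      structConst χ (i, j, l) = 1 := fun i j l hij => by
    rw [structConst, hij, Pi.single_eq_same]
  have hzz : χ (Pi.single z 1) (Pi.single z 1) = Pi.single p 1 := by
    obtain ⟨i, j, hij⟩ := hgen p (by omega) (by omega)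
    have := htri i j p (by rw [hsc i j p hij]; exact one_ne_zero)
    obtain rfl : i = z := Fin.ext (by omega)
    obtain rfl : j = i := Fin.ext (by omega)
    exact hij
  have hzzp : structConst χ (z, z, p) = 1 := hsc _ _ _ hzz
  have hzzq : structConst χ (z, z, q) = 0 := by
    rw [structConst, hzz, Pi.single_eq_of_ne hpq.symm]
  have hp_only : ∀ i j, structConst χ (i, j, p) ≠ 0 → i = z ∧ j = z := by
    intro i j hij
    have := htri i j p hij
    exact ⟨Fin.ext (by omega), Fin.ext (by omega)⟩
  have hlt : ∀ i j, structConst χ (i, j, q) ≠ 0 → (i = z ∨ i = p) ∧ (j = z ∨ j = p) := by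
    intro i j hij
    have := htri i j q hij
    simp only [Fin.ext_iff]
    omega
  have hdp : d p = d z + d z := hgr z z p (by rw [hzzp]; exact one_ne_zero)
  have hdz := (hd z).1
  -- the intermediate structures
  let F : AlgStr k n := ofConst fun i j l =>
    if l = q then structConst χ (i, j, q) - structConst χ (i, j, p) else 0
  let A : AlgStr k n := ofConst fun i j l => if i = z ∧ j = z ∧ l = q then -1 else 0
  have hF : ∀ i j l, structConst F (i, j, l) =
    if l = q then structConst χ (i, j, q) - structConst χ (i, j, p) else 0 :=
    structConst_ofConst _
  have hA : ∀ i j l, structConst A (i, j, l) = if i = z ∧ j = z ∧ l = q then -1 else 0 :=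
    structConst_ofConst _
  have hF_supp : ∀ i j l, structConst F (i, j, l) ≠ 0 →
      l = q ∧ (i = z ∨ i = p) ∧ (j = z ∨ j = p) := by
    intro i j l hl
    rw [hF] at hl
    split_ifs at hl with hlq
    · refine ⟨hlq, ?_⟩
      by_cases h1 : structConst χ (i, j, q) = 0
      · by_cases h2 : structConst χ (i, j, p) = 0
        · simp [h1, h2] at hl
        · have := hp_only i j h2
          tauto
      · exact hlt i j h1
    · exact absurd rfl hl
  have hshear_supp : ∀ i j l, structConst (transport (shear k hpq) χ) (i, j, l) ≠ 0 →
      (l = p ∧ i = z ∧ j = z) ∨ (l = q ∧ (i = z ∨ i = p) ∧ (j = z ∨ j = p)) := by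
    intro i j l hl
    rw [hshear] at hl
    by_cases hc : structConst χ (i, j, l) = 0
    · rw [hc] at hl
      have hlq : l = q := by
        by_contra hlq
        simp [hlq] at hl
      have := hp_only i j (by simpa [hlq] using hl)
      tauto
    · have := htri i j l hc
      simp only [Fin.ext_iff]
      omega
  have hχF : properlyDegenerates χ F := by
    constructor
    · refine degenerates_of_mem_orbit ⟨shear k hpq, rfl⟩ (degenerates_of_weights _ F
        (fun i => if i = q then 2 else if i = z ∨ i = p then 1 else 0) ?_ ?_)
      · intro i j l hl
        obtain ⟨rfl, rfl, rfl⟩ | ⟨rfl, rfl | rfl, rfl | rfl⟩ := hshear_supp i j l hl <;>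
          simp [hzq, hpq]
      · intro i j l
        by_cases hl : structConst (transport (shear k hpq) χ) (i, j, l) = 0
        · rw [hl, ite_self, hF]
          rw [hshear] at hl
          split_ifs with hlq
          · simpa [hlq] using hl
          · rfl
        · obtain ⟨rfl, rfl, rfl⟩ | ⟨rfl, rfl | rfl, rfl | rfl⟩ := hshear_supp i j l hl <;>
            simp [hzq, hpq, hF, hshear]
    · intro hmem
      have h1 := finrank_productSpan_of_mem_orbit hmem
      have h2 : productSpan F ≤ Submodule.span k {Pi.single q 1} := by
        rw [productSpan_le_iff]
        intro i j
        rw [Submodule.mem_span_singleton]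
        refine ⟨structConst F (i, j, q), funext fun l => ?_⟩
        by_cases hl : l = q
        · subst hl; simp [structConst]
        · have : structConst F (i, j, l) = 0 := by rw [hF, if_neg hl]
          simp only [Pi.smul_apply, Pi.single_eq_of_ne hl, smul_zero]
          exact this.symm
      have h3 := Submodule.finrank_mono h2
      have h4 := finrank_span_singleton (K := k) (v := (Pi.single q 1 : Fin n → k))
        (by simp)
      omega
  have hFA : properlyDegenerates F A := by
    constructor
    · refine degenerates_of_weights F A
        (fun i => if i = z then 1 else if i = p ∨ i = q then 2 else 0) ?_ ?_
      · intro i j l hl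
        obtain ⟨rfl, rfl | rfl, rfl | rfl⟩ := hF_supp i j l hl <;>
          simp [hzp.symm, hzq.symm]
      · intro i j l
        by_cases hl : structConst F (i, j, l) = 0
        · rw [hl, ite_self, hA, if_neg]
          rintro ⟨rfl, rfl, rfl⟩
          simp [hF, hzzq, hzzp] at hl
        · obtain ⟨rfl, rfl | rfl, rfl | rfl⟩ := hF_supp i j l hl <;>
          simp [hzp.symm, hzq.symm, hA, hF, hzzp, hzzq]
    · rintro ⟨g, hg⟩
      -- in `A` every element with zero square annihilates everything
      have hAQ : ∀ x, A x x = 0 → ∀ y, A x y = 0 ∧ A y x = 0 := by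
        have hAxy : ∀ x y, A x y = (-(x z * y z)) • Pi.single q 1 := by
          intro x y
          funext l
          simp [A, ofConst_apply, Pi.single_apply, ite_and]
        intro x hx y
        rw [hAxy] at hx
        have : x z = 0 := by simpa using hx
        simp [hAxy, this]
      have hFQ : ∀ x, F x x = 0 → ∀ y, F x y = 0 ∧ F y x = 0 := by
        intro x hx y
        have h1 : ∀ x y, A (g x) (g y) = g (F x y) := fun x y => by
          rw [← hg, transport_apply, g.symm_apply_apply, g.symm_apply_apply]
        have h2 := hAQ (g x) (by rw [h1, hx, map_zero]) (g y)
        simpa [h1] using h2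
      have hFs : ∀ i j l, F (Pi.single i 1) (Pi.single j 1) l = structConst F (i, j, l) :=
        fun _ _ _ => rfl
      have hne : ∀ i j, structConst χ (i, j, p) = 0 ∨ (i = z ∧ j = z) := fun i j => by
        by_cases hij : structConst χ (i, j, p) = 0
        · exact Or.inl hij
        · exact Or.inr (hp_only i j hij)
      obtain ⟨i, j, hij⟩ := hgen q (by omega) (by omega)
      have hijq := hsc i j q hij
      have hij0 : structConst χ (i, j, q) ≠ 0 := by rw [hijq]; exact one_ne_zero
      by_cases hpp : structConst χ (p, p, q) = 0
      · have hsq : F (Pi.single p 1) (Pi.single p 1) = 0 := by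
          funext l
          rw [hFs, hF, hpp]
          have := (hne p p).resolve_right (fun h => hzp h.1.symm)
          simp [this]
        obtain ⟨h1, h2⟩ := hFQ _ hsq (Pi.single z 1)
        have h1 := congrFun h1 q
        have h2 := congrFun h2 q
        rw [hFs, hF, if_pos rfl, (hne _ _).resolve_right (fun h => hzp h.1.symm), sub_zero] at h1
        rw [hFs, hF, if_pos rfl, (hne _ _).resolve_right (fun h => hzp h.2.symm), sub_zero] at h2
        obtain ⟨rfl | rfl, rfl | rfl⟩ := hlt i j hij0
        · exact hij0 hzzq
        · exact hij0 h2
        · exact hij0 h1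
        · exact hij0 hpp
      · have hq4 := hgr p p q hpp
        have hzpq : structConst χ (z, p, q) = 0 := by
          by_contra hc
          have := hgr z p q hc
          omega
        have hpzq : structConst χ (p, z, q) = 0 := by
          by_contra hc
          have := hgr p z q hc
          omega
        obtain ⟨rfl | rfl, rfl | rfl⟩ := hlt i j hij0
        · exact hij0 hzzq
        · exact hij0 hzpq
        · exact hij0 hpzq
        · have e1 := (hne j z).resolve_right (fun h => hzp h.1.symm)
          have e2 := (hne z j).resolve_right (fun h => hzp h.2.symm)
          have e3 := (hne j j).resolve_right (fun h => hzp h.2.symm)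
          have hsq : F (Pi.single z 1 + Pi.single j 1) (Pi.single z 1 + Pi.single j 1) = 0 := by
            funext l
            simp only [map_add, LinearMap.add_apply, Pi.add_apply, hFs, hF]
            split_ifs <;> simp [hzzq, hzzp, hzpq, hpzq, hijq, e1, e2, e3]
          have := congrFun (hFQ _ hsq (Pi.single z 1)).1 q
          simp [hFs, hF, hzzq, hzzp, hpzq, e1] at this
  have hA0 : properlyDegenerates A 0 := by
    constructor
    · refine degenerates_of_weights A 0 (fun _ => 1) (fun _ _ _ _ => by norm_num) ?_
      intro i j l
      simp [structConst]
    · intro hmem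
      obtain ⟨g, hg⟩ := mem_orbit_symm hmem
      have h0 : A = 0 := by
        rw [← hg]
        exact LinearMap.ext₂ fun x y => by simp [transport_apply]
      have := hA z z q
      rw [h0] at this
      simp [structConst] at this
  exact ((hasChain.cons ⟨fun _ => 0, rfl, fun i hi => absurd hi (by omega)⟩ hA0).cons hFA).cons hχF

lemma IsGradedMonomial.hasChain [Infinite k] {m : ℕ} (hmn : m + 3 ≤ n) {χ : AlgStr k n}
    (h : IsGradedMonomial (m + 3) χ) : hasChain χ (m + 3) := by
  induction m generalizing χ with
  | zero => exact h.hasChain_three hmn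
  | succ m ih =>
    obtain ⟨ψ, hψ, hdeg⟩ := h.exists_properlyDegenerates (m := m + 2) hmn
    exact (ih (by omega) hψ).cons hdeg

end Chains

section AdaptedBasis

variable {n : ℕ}

lemma mem_subalgGen (μ : AlgStr k n) (a : Fin n → k) : a ∈ subalgGen μ {a} := by
  rw [subalgGen, Submodule.mem_sInf]
  exact fun W hW => hW.1 rfl

lemma mul_mem_subalgGen (μ : AlgStr k n) (S : Set (Fin n → k)) {x y : Fin n → k}
    (hx : x ∈ subalgGen μ S) (hy : y ∈ subalgGen μ S) : μ x y ∈ subalgGen μ S := by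
  rw [subalgGen, Submodule.mem_sInf] at *
  exact fun W hW => hW.2 x (hx W hW) y (hy W hW)

lemma subalgGen_le {μ : AlgStr k n} {S : Set (Fin n → k)} {W : Submodule k (Fin n → k)}
    (hS : S ⊆ W) (hW : ∀ x ∈ W, ∀ y ∈ W, μ x y ∈ W) : subalgGen μ S ≤ W :=
  sInf_le ⟨hS, hW⟩

lemma mul_mem_span {μ : AlgStr k n} {S : Set (Fin n → k)} {W : Submodule k (Fin n → k)}
    (h : ∀ x ∈ S, ∀ y ∈ S, μ x y ∈ W) {x y : Fin n → k} (hx : x ∈ Submodule.span k S)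
    (hy : y ∈ Submodule.span k S) : μ x y ∈ W := by
  have h1 : ∀ x ∈ S, Submodule.span k S ≤ W.comap (μ x) := fun x hx =>
    Submodule.span_le.2 fun y hy => h x hx y hy
  have h2 : Submodule.span k S ≤ W.comap (μ.flip y) :=
    Submodule.span_le.2 fun x hx => h1 x hx hy
  exact h2 hx

/-- Greedy choice of linearly independent monomials `e 0, …, e s` in `a`, of degrees `d`: every
product of two of them is either in the span of those of no larger degree, or has degree at
least that of all of them. -/
lemma exists_monomials (μ : AlgStr k n) (a : Fin n → k) (s : ℕ)
    (hs : s + 1 ≤ Module.finrank k (subalgGen μ {a})) :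
    ∃ (e : ℕ → Fin n → k) (d : ℕ → ℕ), LinearIndependent k (fun i : Fin (s + 1) => e i) ∧
      e 0 = a ∧ d 0 = 1 ∧ (∀ i j, i ≤ j → j ≤ s → d i ≤ d j) ∧
      (∀ l, 1 ≤ l → l ≤ s → ∃ i < l, ∃ j < l, e l = μ (e i) (e j) ∧ d l = d i + d j) ∧
      ∀ i ≤ s, ∀ j ≤ s, (∀ l ≤ s, d l ≤ d i + d j) ∨
        μ (e i) (e j) ∈ Submodule.span k (e '' {p | p ≤ s ∧ d p ≤ d i + d j}) := by
  classical
  induction s with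
  | zero =>
    refine ⟨fun _ => a, fun _ => 1, ?_, rfl, rfl, by simp, by omega, by simp⟩
    refine LinearIndependent.of_subsingleton (v := fun _ : Fin 1 => a) 0 ?_
    rintro rfl
    have : subalgGen μ {0} = ⊥ := le_bot_iff.1 (subalgGen_le (by simp) (by simp))
    rw [this, finrank_bot] at hs
    omega
  | succ s ih =>
    obtain ⟨e, d, hli, he0, hd0, hmono, hgen, hfil⟩ := ih (by omega)
    have hrange : Set.range (fun i : Fin (s + 1) => e i) = e '' {p | p ≤ s} := by
      ext v
      constructor
      · rintro ⟨i, rfl⟩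
        exact ⟨i, Nat.lt_succ_iff.1 i.2, rfl⟩
      · rintro ⟨p, hp, rfl⟩
        exact ⟨⟨p, Nat.lt_succ_iff.2 hp⟩, rfl⟩
    have hbad : ∃ D, ∃ i ≤ s, ∃ j ≤ s, d i + d j = D ∧
        μ (e i) (e j) ∉ Submodule.span k (e '' {p | p ≤ s ∧ d p ≤ d i + d j}) := by
      by_contra! hall
      have hle : subalgGen μ {a} ≤ Submodule.span k (e '' {p | p ≤ s}) := by
        refine subalgGen_le ?_ fun x hx y hy => mul_mem_span ?_ hx hy
        · rintro _ rfl
          exact Submodule.subset_span ⟨0, Nat.zero_le s, he0⟩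
        · rintro _ ⟨i, hi, rfl⟩ _ ⟨j, hj, rfl⟩
          exact Submodule.span_mono (Set.image_mono fun p hp => hp.1) (hall _ i hi j hj rfl)
      have h1 := Submodule.finrank_mono hle
      rw [← hrange, finrank_span_eq_card hli, Fintype.card_fin] at h1
      omega
    obtain ⟨i₀, hi₀, j₀, hj₀, hD, hnot⟩ := Nat.find_spec hbad
    have hmin := fun D (hD : D < Nat.find hbad) => Nat.find_min hbad hD
    generalize Nat.find hbad = D at hD hmin
    have htop : ∀ l ≤ s, d l ≤ D := by
      rw [← hD]
      exact (hfil i₀ hi₀ j₀ hj₀).resolve_right hnot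
    have hnot' : μ (e i₀) (e j₀) ∉ Submodule.span k (e '' {p | p ≤ s}) := by
      refine fun h => hnot (Submodule.span_mono (Set.image_mono ?_) h)
      exact fun p hp => ⟨hp, hD.symm ▸ htop p hp⟩
    have hpos : ∀ l ≤ s, 1 ≤ d l := fun l hl => hd0 ▸ hmono 0 l (Nat.zero_le l) hl
    set e' := Function.update e (s + 1) (μ (e i₀) (e j₀)) with he'
    set d' := Function.update d (s + 1) D with hd'
    have hes : e' (s + 1) = μ (e i₀) (e j₀) := Function.update_self ..
    have hds : d' (s + 1) = D := Function.update_self ..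
    have heo : ∀ i ≤ s, e' i = e i := fun i hi => Function.update_of_ne (by omega) ..
    have hdo : ∀ i ≤ s, d' i = d i := fun i hi => Function.update_of_ne (by omega) ..
    have htop' : ∀ l ≤ s + 1, d' l ≤ D := by
      intro l hl
      rcases Nat.le_succ_iff.1 hl with hl | rfl
      · rw [hdo l hl]; exact htop l hl
      · exact hds.le
    refine ⟨e', d', ?_, by rw [heo 0 (Nat.zero_le s), he0], by rw [hdo 0 (Nat.zero_le s), hd0],
      fun i j hij hj => ?_, fun l h1 hl => ?_, fun i hi j hj => ?_⟩
    · have hinit : Fin.init (fun i : Fin (s + 1 + 1) => e' i) = fun i : Fin (s + 1) => e i :=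
        funext fun i => heo i (Nat.lt_succ_iff.1 i.2)
      rw [linearIndependent_finSucc', hinit, hrange]
      refine ⟨hli, ?_⟩
      simpa only [Fin.val_last, hes] using hnot'
    · rcases Nat.le_succ_iff.1 hj with hj | rfl
      · rw [hdo i (hij.trans hj), hdo j hj]
        exact hmono i j hij hj
      · rw [hds]
        exact htop' i hij
    · rcases Nat.le_succ_iff.1 hl with hl | rfl
      · obtain ⟨i, hi, j, hj, h⟩ := hgen l h1 hl
        refine ⟨i, hi, j, hj, ?_⟩
        rwa [heo l hl, heo i (by omega), heo j (by omega), hdo l hl, hdo i (by omega),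
          hdo j (by omega)]
      · refine ⟨i₀, by omega, j₀, by omega, ?_⟩
        rw [hes, hds, heo i₀ hi₀, heo j₀ hj₀, hdo i₀ hi₀, hdo j₀ hj₀]
        exact ⟨rfl, hD.symm⟩
    · rcases le_or_gt D (d' i + d' j) with hDle | hlt
      · exact Or.inl fun l hl => (htop' l hl).trans hDle
      · right
        have hi : i ≤ s := by
          by_contra hc
          obtain rfl : i = s + 1 := by omega
          omega
        have hj : j ≤ s := by
          by_contra hc
          obtain rfl : j = s + 1 := by omega
          omega
        rw [hdo i hi, hdo j hj] at hlt ⊢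
        have hmem := hmin _ hlt
        push Not at hmem
        have hmem := hmem i hi j hj rfl
        rw [heo i hi, heo j hj]
        refine Submodule.span_mono ?_ hmem
        rintro _ ⟨p, ⟨hp, hpd⟩, rfl⟩
        exact ⟨p, ⟨hp.trans (Nat.le_succ s), by rwa [hdo p hp]⟩, heo p hp⟩

lemma LinearIndependent.exists_basis_fin {m : ℕ} (hmn : m ≤ n) {v : Fin m → Fin n → k}
    (hv : LinearIndependent k v) :
    ∃ b : Module.Basis (Fin n) k (Fin n → k), ∀ i, b (Fin.castLE hmn i) = v i := by
  have key : ∀ N (h : m ≤ N), N ≤ n →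
      ∃ w : Fin N → Fin n → k, LinearIndependent k w ∧ ∀ i, w (Fin.castLE h i) = v i := by
    intro N h
    induction N, h using Nat.le_induction with
    | base => exact fun _ => ⟨v, hv, fun i => rfl⟩
    | succ N h ih =>
      intro hN
      obtain ⟨w, hw, hwv⟩ := ih (by omega)
      obtain ⟨x, hx⟩ := exists_linearIndependent_snoc_of_lt_finrank hw
        (by rw [Module.finrank_fin_fun]; omega)
      refine ⟨Fin.snoc w x, hx, fun i => ?_⟩
      rw [← hwv i]
      exact Fin.snoc_castSucc (α := fun _ => Fin n → k) x w (Fin.castLE h i)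
  obtain ⟨w, hw, hwv⟩ := key n hmn le_rfl
  refine ⟨basisOfLinearIndependentOfCardEqFinrank' w hw (by simp), fun i => ?_⟩
  rw [coe_basisOfLinearIndependentOfCardEqFinrank', hwv]

/-- A basis adapted to the filtration, by degree of monomials, of the subalgebra generated by a
single element. -/
lemma exists_adapted_basis (μ : AlgStr k n) {m : ℕ} (hm : 1 ≤ m) (hmn : m ≤ n) (a : Fin n → k)
    (ha : Module.finrank k (subalgGen μ {a}) = m) :
    ∃ (b : Module.Basis (Fin n) k (Fin n → k)) (d : Fin n → ℕ),
      (∀ i : Fin n, (i : ℕ) = 0 → d i = 1) ∧ (∀ i, 1 ≤ d i) ∧ Monotone d ∧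
      (∀ l : Fin n, 1 ≤ (l : ℕ) → (l : ℕ) < m →
        ∃ i < l, ∃ j < l, b l = μ (b i) (b j) ∧ d l = d i + d j) ∧
      (∀ i j l, b.repr (μ (b i) (b j)) l ≠ 0 → d l ≤ d i + d j) ∧
      ∀ i j l, b.repr (μ (b i) (b j)) l ≠ 0 → d l = d i + d j → (l : ℕ) < m := by
  obtain ⟨s, rfl⟩ : ∃ s, m = s + 1 := ⟨m - 1, by omega⟩
  obtain ⟨e, d, hli, he0, hd0, hmono, hgen, hfil⟩ := exists_monomials μ a s ha.ge
  obtain ⟨b, hb⟩ := hli.exists_basis_fin hmn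
  have hb : ∀ i : Fin n, (i : ℕ) ≤ s → b i = e i := fun i hi => hb ⟨i, Nat.lt_succ_iff.2 hi⟩
  have hmem : ∀ l ≤ s, e l ∈ subalgGen μ {a} := by
    intro l
    induction l using Nat.strong_induction_on with
    | _ l ih =>
      intro hl
      rcases Nat.eq_zero_or_pos l with rfl | hpos
      · rw [he0]; exact mem_subalgGen μ a
      · obtain ⟨i, hi, j, hj, h, -⟩ := hgen l hpos hl
        rw [h]
        exact mul_mem_subalgGen μ _ (ih i hi (by omega)) (ih j hj (by omega))
  have hspan : Submodule.span k (Set.range fun i : Fin (s + 1) => e i) = subalgGen μ {a} := by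
    refine Submodule.eq_of_le_of_finrank_eq (Submodule.span_le.2 ?_) ?_
    · rintro _ ⟨i, rfl⟩
      exact hmem i (Nat.lt_succ_iff.1 i.2)
    · rw [finrank_span_eq_card hli, Fintype.card_fin, ha]
  have hfil' : ∀ i ≤ s, ∀ j ≤ s,
      μ (e i) (e j) ∈ Submodule.span k (e '' {p | p ≤ s ∧ d p ≤ d i + d j}) := by
    intro i hi j hj
    refine (hfil i hi j hj).elim (fun h => ?_) id
    have := mul_mem_subalgGen μ _ (hmem i hi) (hmem j hj)
    rw [← hspan] at this
    refine Submodule.span_mono ?_ this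
    rintro _ ⟨p, rfl⟩
    have hp := Nat.lt_succ_iff.1 p.2
    exact ⟨p, ⟨hp, h p hp⟩, rfl⟩
  have hpos : ∀ l ≤ s, 1 ≤ d l := fun l hl => hd0 ▸ hmono 0 l (Nat.zero_le l) hl
  have hrepr : ∀ i j l : Fin n, (i : ℕ) ≤ s → (j : ℕ) ≤ s → b.repr (μ (b i) (b j)) l ≠ 0 →
      (l : ℕ) ≤ s ∧ d l ≤ d i + d j := by
    intro i j l hi hj hl
    have h := hfil' i hi j hj
    have himg : e '' {p | p ≤ s ∧ d p ≤ d i + d j} =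
        b '' {p : Fin n | (p : ℕ) ≤ s ∧ d p ≤ d i + d j} := by
      ext v
      constructor
      · rintro ⟨p, hp, rfl⟩
        exact ⟨⟨p, by have := hp.1; omega⟩, hp, hb _ hp.1⟩
      · rintro ⟨p, hp, rfl⟩
        exact ⟨p, hp, (hb p hp.1).symm⟩
    rw [himg, ← hb i hi, ← hb j hj, Module.Basis.mem_span_image] at h
    exact h (Finsupp.mem_support_iff.2 hl)
  let d' : Fin n → ℕ := fun i => if (i : ℕ) ≤ s then d i else d s + 1
  have hd' : ∀ i : Fin n, (i : ℕ) ≤ s → d' i = d i := fun i hi => if_pos hi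
  have hd'' : ∀ i : Fin n, ¬ (i : ℕ) ≤ s → d' i = d s + 1 := fun i hi => if_neg hi
  have hd'_le : ∀ i, d' i ≤ d s + 1 := fun i => by
    by_cases hi : (i : ℕ) ≤ s
    · rw [hd' i hi]; have := hmono i s hi le_rfl; omega
    · exact (hd'' i hi).le
  have hd'_pos : ∀ i, 1 ≤ d' i := fun i => by
    by_cases hi : (i : ℕ) ≤ s
    · rw [hd' i hi]; exact hpos i hi
    · rw [hd'' i hi]; omega
  refine ⟨b, d', fun i hi => ?_, hd'_pos, fun i j hij => ?_, fun l h1 hl => ?_,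
    fun i j l hl => ?_, fun i j l hl hdl => ?_⟩
  · rw [hd' i (by omega), hi, hd0]
  · have hij : (i : ℕ) ≤ j := hij
    by_cases hj : (j : ℕ) ≤ s
    · rw [hd' j hj, hd' i (hij.trans hj)]
      exact hmono i j hij hj
    · rw [hd'' j hj]
      exact hd'_le i
  · obtain ⟨i, hi, j, hj, h, h'⟩ := hgen l h1 (by omega)
    refine ⟨⟨i, by omega⟩, hi, ⟨j, by omega⟩, hj, ?_⟩
    rw [hb l (by omega), hb _ (by simp only; omega), hb _ (by simp only; omega), hd' l (by omega),
      hd' _ (by simp only; omega), hd' _ (by simp only; omega)]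
    exact ⟨h, h'⟩
  · by_cases hi : (i : ℕ) ≤ s
    · by_cases hj : (j : ℕ) ≤ s
      · obtain ⟨h1, h2⟩ := hrepr i j l hi hj hl
        rwa [hd' l h1, hd' i hi, hd' j hj]
      · rw [hd'' j hj]
        exact (hd'_le l).trans (by omega)
    · rw [hd'' i hi]
      exact (hd'_le l).trans (by omega)
  · have hi : (i : ℕ) ≤ s := by
      by_contra hi
      have := hd'' i hi
      have := hd'_le l
      have := hd'_pos j
      omega
    have hj : (j : ℕ) ≤ s := by
      by_contra hj
      have := hd'' j hj
      have := hd'_le l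
      have := hd'_pos i
      omega
    exact Nat.lt_succ_iff.2 (hrepr i j l hi hj hl).1

end AdaptedBasis

section Standard

variable {n : ℕ}

/-- The vectors supported on the coordinates of degree `q`. -/
def gradedPart (k : Type*) [Field k] {m : ℕ} (d : Fin m → ℕ) (q : ℕ) :
    Submodule k (Fin m → k) where
  carrier := {x | ∀ i, d i ≠ q → x i = 0}
  add_mem' hx hy i hi := by simp [hx i hi, hy i hi]
  zero_mem' _ _ := rfl
  smul_mem' a x hx i hi := by simp [hx i hi]

lemma isInternal_gradedPart {m : ℕ} (d : Fin m → ℕ) : DirectSum.IsInternal (gradedPart k d) := by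
  rw [DirectSum.isInternal_submodule_iff_iSupIndep_and_iSup_eq_top]
  constructor
  · intro q
    rw [Submodule.disjoint_def]
    intro x hx hx'
    let W : Submodule k (Fin m → k) :=
      ⨅ i ∈ {i | d i = q}, LinearMap.ker (LinearMap.proj i : (Fin m → k) →ₗ[k] k)
    have hle : (⨆ (p) (_ : p ≠ q), gradedPart k d p) ≤ W := by
      refine iSup₂_le fun p hp y hy => ?_
      simp only [W, Submodule.mem_iInf, LinearMap.mem_ker, LinearMap.proj_apply]
      intro i hi
      exact hy i (by rw [show d i = q from hi]; exact hp.symm)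
    have hxW := hle hx'
    simp only [W, Submodule.mem_iInf, LinearMap.mem_ker, LinearMap.proj_apply] at hxW
    funext i
    by_cases hi : d i = q
    · exact hxW i hi
    · exact hx i hi
  · rw [eq_top_iff]
    intro x _
    rw [← Finset.univ_sum_single x]
    refine Submodule.sum_mem _ fun i _ => Submodule.mem_iSup_of_mem (d i) fun j hj => ?_
    rw [Pi.single_eq_of_ne]
    rintro rfl
    exact hj rfl

lemma IsGradedMonomial.standardOneGenerated {m : ℕ} {B : AlgStr k m} (h : IsGradedMonomial m B)
    (hm : 1 ≤ m) : StandardOneGenerated B := by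
  obtain ⟨⟨d, hd, hgr⟩, htri, hgen⟩ := h
  let z : Fin m := ⟨0, hm⟩
  have hdz : d z = 1 := (hd z).2 rfl
  have hd1 : ∀ i, d i = 1 → i = z := by
    intro l hl
    by_contra hne
    have hl1 : 1 ≤ (l : ℕ) := Nat.one_le_iff_ne_zero.2 fun h => hne (Fin.ext h)
    obtain ⟨i, j, hij⟩ := hgen l hl1 l.2
    have := hgr i j l (by rw [structConst, hij, Pi.single_eq_same]; exact one_ne_zero)
    have := (hd i).1
    have := (hd j).1
    omega
  have hmem1 : (Pi.single z 1 : Fin m → k) ∈ gradedPart k d 1 := fun i hi => by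
    rw [Pi.single_eq_of_ne]
    rintro rfl
    exact hi hdz
  refine ⟨gradedPart k d, ?_, isInternal_gradedPart d, ?_, fun p q x hx y hy l hl => ?_, ?_⟩
  · rw [eq_bot_iff]
    intro x hx
    refine (Submodule.mem_bot k).2 (funext fun i => hx i ?_)
    have := (hd i).1
    omega
  · have : gradedPart k d 1 = Submodule.span k {(Pi.single z 1 : Fin m → k)} := by
      refine le_antisymm (fun x hx => ?_) ?_
      · refine Submodule.mem_span_singleton.2 ⟨x z, funext fun i => ?_⟩
        by_cases hi : i = z
        · subst hi; simp
        · rw [hx i (mt (hd1 i) hi)]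
          simp [hi]
      · rw [Submodule.span_singleton_le_iff_mem]
        exact hmem1
    rw [this, finrank_span_singleton]
    simp
  · rw [eq_ofConst B, ofConst_apply]
    refine Finset.sum_eq_zero fun i _ => Finset.sum_eq_zero fun j _ => ?_
    by_cases hi : d i = p
    · by_cases hj : d j = q
      · have : structConst B (i, j, l) = 0 := by
          by_contra hc
          exact hl (by rw [hgr i j l hc, hi, hj])
        rw [this, mul_zero]
      · rw [hy j hj, mul_zero, zero_mul]
    · rw [hx i hi, zero_mul, zero_mul]
  · have hall : ∀ N, ∀ l : Fin m, (l : ℕ) = N → (Pi.single l 1 : Fin m → k) ∈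
        subalgGen B ((gradedPart k d 1 : Submodule k (Fin m → k)) : Set (Fin m → k)) := by
      intro N
      induction N using Nat.strong_induction_on with
      | _ N ih =>
        rintro l rfl
        rcases Nat.eq_zero_or_pos (l : ℕ) with h0 | hpos
        · obtain rfl : l = z := Fin.ext h0
          rw [subalgGen, Submodule.mem_sInf]
          exact fun W hW => hW.1 hmem1
        · obtain ⟨i, j, hij⟩ := hgen l hpos l.2
          have := htri i j l (by rw [structConst, hij, Pi.single_eq_same]; exact one_ne_zero)
          rw [← hij]
          exact mul_mem_subalgGen B _ (ih i this.1 i rfl) (ih j this.2.1 j rfl)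
    rw [eq_top_iff]
    intro x _
    rw [← Finset.univ_sum_single x]
    refine Submodule.sum_mem _ fun l _ => ?_
    have : (Pi.single l (x l) : Fin m → k) = x l • Pi.single l 1 := by
      rw [← Pi.single_smul, smul_eq_mul, mul_one]
    rw [this]
    exact Submodule.smul_mem _ _ (hall l l rfl)

lemma structConst_extendZero {m : ℕ} (hmn : m ≤ n) (B : AlgStr k m) (i j l : Fin n) :
    structConst (extendZero hmn B) (i, j, l) =
      if h : (i : ℕ) < m ∧ (j : ℕ) < m ∧ (l : ℕ) < m then
        structConst B (⟨i, h.1⟩, ⟨j, h.2.1⟩, ⟨l, h.2.2⟩) else 0 := by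
  have hlt : ∀ (i : Fin n) (hi : (i : ℕ) < m),
      LinearMap.funLeft k k (Fin.castLE hmn) (Pi.single i 1) = Pi.single ⟨i, hi⟩ 1 := by
    intro i hi
    funext j
    simp [LinearMap.funLeft_apply, Pi.single_apply, Fin.ext_iff]
  have hge : ∀ (i : Fin n), ¬ (i : ℕ) < m →
      LinearMap.funLeft k k (Fin.castLE hmn) (Pi.single i (1 : k)) = 0 := by
    intro i hi
    funext j
    rw [LinearMap.funLeft_apply, Pi.single_eq_of_ne, Pi.zero_apply]
    rintro rfl
    exact hi j.2
  have happ : structConst (extendZero hmn B) (i, j, l) =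
      if hl : (l : ℕ) < m then B (LinearMap.funLeft k k (Fin.castLE hmn) (Pi.single i 1))
        (LinearMap.funLeft k k (Fin.castLE hmn) (Pi.single j 1)) ⟨l, hl⟩ else 0 := rfl
  rw [happ]
  by_cases hi : (i : ℕ) < m
  · by_cases hj : (j : ℕ) < m
    · simp [hi, hj, hlt, structConst]
    · simp [hge j hj, hj]
  · simp [hge i hi, hi]

lemma IsGradedMonomial.exists_extendZero_eq {m : ℕ} (hm : 1 ≤ m) (hmn : m ≤ n) {χ : AlgStr k n}
    (h : IsGradedMonomial m χ) :
    ∃ B : AlgStr k m, StandardOneGenerated B ∧ extendZero hmn B = χ := by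
  obtain ⟨⟨d, hd, hgr⟩, htri, hgen⟩ := h
  let B : AlgStr k m := ofConst fun i j l =>
    structConst χ (Fin.castLE hmn i, Fin.castLE hmn j, Fin.castLE hmn l)
  have hB : ∀ i j l, structConst B (i, j, l) =
    structConst χ (Fin.castLE hmn i, Fin.castLE hmn j, Fin.castLE hmn l) := structConst_ofConst _
  refine ⟨B, IsGradedMonomial.standardOneGenerated ⟨⟨fun i => d (Fin.castLE hmn i),
    fun i => hd _, fun i j l hl => hgr _ _ _ (by rwa [hB] at hl)⟩, fun i j l hl => ?_,
    fun l h1 hl => ?_⟩ hm, structConst_injective (funext fun ⟨i, j, l⟩ => ?_)⟩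
  · rw [hB] at hl
    exact htri _ _ _ hl
  · obtain ⟨i, j, hij⟩ := hgen (Fin.castLE hmn l) h1 hl
    have := htri i j _ (by rw [structConst, hij, Pi.single_eq_same]; exact one_ne_zero)
    have hil : (i : ℕ) < l := this.1
    have hjl : (j : ℕ) < l := this.2.1
    refine ⟨⟨i, by omega⟩, ⟨j, by omega⟩, funext fun l' => ?_⟩
    refine (hB _ _ l').trans ((congrFun hij _).trans ?_)
    simp [Pi.single_apply, Fin.ext_iff]
  · rw [structConst_extendZero]
    split_ifs with hlt
    · exact hB _ _ _
    · by_contra hc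
      have := htri i j l (Ne.symm hc)
      omega

/-- Every structure degenerates to the structure of the associated graded algebra of a
one-generated subalgebra, extended by zero. -/
lemma exists_isGradedMonomial_degenerates [Infinite k] (μ : AlgStr k n) {m : ℕ} (hm : 1 ≤ m)
    (hmn : m ≤ n) (a : Fin n → k) (ha : Module.finrank k (subalgGen μ {a}) = m) :
    ∃ χ : AlgStr k n, IsGradedMonomial m χ ∧ degenerates μ χ := by
  obtain ⟨b, d, hd0, hd1, hmono, hgen, hle, hlt⟩ := exists_adapted_basis μ hm hmn a ha
  have hb : ∀ i, b.equivFun.symm (Pi.single i 1) = b i := fun i => by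
    rw [LinearEquiv.symm_apply_eq]
    funext j
    rw [b.equivFun_self]
    simp [Pi.single_apply, eq_comm]
  have htr : ∀ i j l, structConst (transport b.equivFun μ) (i, j, l) =
      b.repr (μ (b i) (b j)) l := fun i j l => by
    rw [structConst, transport_apply, hb, hb, b.equivFun_apply]
  let χ : AlgStr k n := ofConst fun i j l =>
    if d l = d i + d j then b.repr (μ (b i) (b j)) l else 0
  have hχ : ∀ i j l, structConst χ (i, j, l) =
    if d l = d i + d j then b.repr (μ (b i) (b j)) l else 0 := structConst_ofConst _
  refine ⟨χ, ⟨⟨d, fun i => ⟨hd1 i, hd0 i⟩, fun i j l hl => ?_⟩, fun i j l hl => ?_,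
    fun l h1 hl => ?_⟩, degenerates_of_mem_orbit ⟨b.equivFun, rfl⟩
      (degenerates_of_weights _ χ (fun i => d i) (fun i j l hl => ?_) fun i j l => ?_)⟩
  · rw [hχ] at hl
    exact (ite_ne_right_iff.1 hl).1
  · rw [hχ] at hl
    obtain ⟨h1, h2⟩ := ite_ne_right_iff.1 hl
    have hi := hd1 i
    have hj := hd1 j
    exact ⟨hmono.reflect_lt (by omega), hmono.reflect_lt (by omega), hlt i j l h2 h1⟩
  · obtain ⟨i, -, j, -, hij, hdl⟩ := hgen l h1 hl
    refine ⟨i, j, funext fun l' => (hχ i j l').trans ?_⟩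
    rw [← hij, b.repr_self]
    by_cases hl' : l' = l
    · subst hl'; simp [hdl]
    · simp [hl']
  · rw [htr] at hl
    exact_mod_cast hle i j l hl
  · rw [hχ, htr]
    norm_cast

end Standard

/-! ## STATEMENT 3 -/
theorem stmt3 {k : Type*} [Field k] [IsAlgClosed k] (n m : ℕ) (hm : 3 ≤ m) (hmn : m ≤ n)
    (μ : AlgStr k n) (hG : genType μ m) :
    hasChain μ m ∧
      ((¬ ∃ B : AlgStr k m, StandardOneGenerated B ∧ extendZero hmn B ∈ orbit μ) →
        hasChain μ (m + 1)) := by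
  have : Infinite k := IsAlgClosed.instInfinite
  obtain ⟨a, ha⟩ := hG.1
  obtain ⟨χ, hχ, hdeg⟩ := exists_isGradedMonomial_degenerates μ (by omega) hmn a ha
  have hchain : hasChain χ m := by
    obtain ⟨m, rfl⟩ := Nat.exists_eq_add_of_le' hm
    exact hχ.hasChain hmn
  by_cases horb : χ ∈ orbit μ
  · refine ⟨hchain.of_mem_orbit (by omega) horb, fun hno => absurd ?_ hno⟩
    obtain ⟨B, hB, rfl⟩ := hχ.exists_extendZero_eq (by omega) hmn
    exact ⟨B, hB, horb⟩
  · have := hchain.cons ⟨hdeg, horb⟩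
    exact ⟨this.of_succ, fun _ => this⟩

end
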